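/- Let (Ω, F, P) be a probability space with filtration (F_u)_{u ∈ [0,T]}, T > 0, and let r, γ, δ : [0, T] × Ω → ℝ be jointly measurable and bounded with γ ∈ [0, 1). Let ν : Ω → Measure([0, T]) be a measurable family of finite measures with uniformly bounded total mass. For u ∈ [0, T] set ξ(u, ω) = ∫_{(u,T]} exp(−∫_u^s ((1 − γ(τ, ω)) r(τ, ω) − δ(τ, ω)) dτ) ν(ω)(ds), and let V : [0, T] × Ω → ℝ be a jointly measurable version with V(u, ·) = E[ξ(u, ·) | F_u] almost surely for each u. Then for every t ∈ [0, T], almost surely, E[ ∫_t^T (γ(u)r(u) + δ(u)) e^{−∫_0^u r(τ)dτ} V(u, ·) du | F_t ] = E[ ∫_{(t,T]} e^{−∫_0^s r(τ)dτ} ( e^{∫_t^s (γ(τ)r(τ) + δ(τ)) dτ} − 1 ) ν(ds) | F_t ]. -/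

import Mathlib

open MeasureTheory Set

lemma ts_ii {f : ℝ → ℝ} (hf : Measurable f) {C : ℝ} (hC : ∀ x, |f x| ≤ C) (a b : ℝ) :
    IntervalIntegrable f volume a b := by
  rw [intervalIntegrable_iff]
  exact Measure.integrableOn_of_bounded (M := C) (by simp)
    hf.aestronglyMeasurable (Filter.Eventually.of_forall hC)

lemma ts_calc {g : ℝ → ℝ} (hg : Measurable g) {C : ℝ} (hC : ∀ x, |g x| ≤ C) {t s : ℝ}
    (hts : t ≤ s) :
    ∫ u in t..s, g u * Real.exp (∫ τ in u..s, g τ) = Real.exp (∫ τ in t..s, g τ) - 1 := by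
  have hC0 : 0 ≤ C := (abs_nonneg _).trans (hC 0)
  have hii := ts_ii hg hC
  set F : ℝ → ℝ := fun u => Real.exp (∫ τ in u..s, g τ) with hF
  have hlip : LipschitzWith C.toNNReal (fun u => ∫ τ in u..s, g τ) := by
    refine LipschitzWith.of_dist_le_mul fun x y => ?_
    have h0 : (∫ τ in x..s, g τ) - ∫ τ in y..s, g τ = ∫ τ in x..y, g τ := by
      rw [← intervalIntegral.integral_add_adjacent_intervals (hii x y) (hii y s)]; ring
    rw [Real.dist_eq, Real.dist_eq, h0, Real.coe_toNNReal _ hC0, abs_sub_comm]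
    exact intervalIntegral.norm_integral_le_of_norm_le_const (f := g) (fun x _ => hC x)
  have hexp : LipschitzOnWith (Real.exp (C * (s - t))).toNNReal Real.exp
      (Iic (C * (s - t))) := by
    refine Convex.lipschitzOnWith_of_nnnorm_deriv_le (fun x _ => Real.differentiableAt_exp) ?_
      (convex_Iic _)
    intro x hx
    rw [Real.deriv_exp, ← NNReal.coe_le_coe, coe_nnnorm, Real.norm_eq_abs, Real.abs_exp,
      Real.coe_toNNReal _ (Real.exp_pos _).le]
    exact Real.exp_le_exp.2 hx
  have hAC : AbsolutelyContinuousOnInterval F t s := by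
    refine LipschitzOnWith.absolutelyContinuousOnInterval
      (hexp.comp (hlip.lipschitzOnWith (s := uIcc t s)) ?_)
    intro u hu
    rw [uIcc_of_le hts] at hu
    have := intervalIntegral.norm_integral_le_of_norm_le_const (a := u) (b := s) (f := g) (C := C)
      (fun x _ => hC x)
    rw [Real.norm_eq_abs, abs_of_nonneg (sub_nonneg.2 hu.2)] at this
    have h2 : C * (s - u) ≤ C * (s - t) := by gcongr; exact hu.1
    exact (le_abs_self _).trans (this.trans h2)
  have h1 := hAC.integral_deriv_eq_sub
  have h3 : ∫ u in t..s, g u * Real.exp (∫ τ in u..s, g τ) = ∫ u in t..s, - deriv F u := by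
    apply intervalIntegral.integral_congr_ae
    filter_upwards [(hii t s).ae_hasDerivAt_integral] with x hx hx'
    have h4 := hx (uIoc_subset_uIcc hx') s right_mem_uIcc
    have h5 : HasDerivAt (fun u => ∫ τ in u..s, g τ) (- g x) x := by
      have : (fun u => ∫ τ in u..s, g τ) = fun u => - ∫ τ in s..u, g τ := by
        funext u; rw [intervalIntegral.integral_symm]
      rw [this]; exact h4.neg
    rw [show deriv F x = _ from h5.exp.deriv]
    ring
  rw [h3, intervalIntegral.integral_neg, h1]
  simp [hF]

lemma ts_meas {Ω : Type*} {m : MeasurableSpace Ω} {f : ℝ → Ω → ℝ}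
    (hf : Measurable (Function.uncurry f)) :
    Measurable (fun p : ℝ × Ω => ∫ τ in (0:ℝ)..p.1, f τ p.2) := by
  have key : ∀ S : Set ((ℝ × Ω) × ℝ), MeasurableSet S → 
      Measurable (fun p : ℝ × Ω => ∫ τ, S.indicator (fun q => f q.2 q.1.2) (p, τ)) := by
    intro S hS
    apply StronglyMeasurable.measurable
    apply StronglyMeasurable.integral_prod_right (f := fun p τ => S.indicator (fun q => f q.2 q.1.2) (p, τ))
    apply Measurable.stronglyMeasurable
    apply Measurable.indicator _ hS
    exact hf.comp (measurable_snd.prodMk (measurable_snd.comp measurable_fst))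
  have h1 := key {q | 0 < q.2 ∧ q.2 ≤ q.1.1} (by
    apply MeasurableSet.inter
    · exact measurableSet_lt measurable_const measurable_snd
    · exact measurableSet_le measurable_snd (by fun_prop))
  have h2 := key {q | q.1.1 < q.2 ∧ q.2 ≤ 0} (by
    apply MeasurableSet.inter
    · exact measurableSet_lt (by fun_prop) measurable_snd
    · exact measurableSet_le measurable_snd (by fun_prop))
  convert h1.sub h2 using 1
  funext p
  simp only [intervalIntegral, Pi.sub_apply]
  rw [← integral_indicator measurableSet_Ioc, ← integral_indicator measurableSet_Ioc]
  rfl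

lemma ts_path {r g : ℝ → ℝ} (hr : Measurable r) (hg : Measurable g) {C : ℝ}
    (hrC : ∀ x, |r x| ≤ C) (hgC : ∀ x, |g x| ≤ C) {t T : ℝ} (htT : t ≤ T)
    (ν : Measure ℝ) [IsFiniteMeasure ν] :
    ∫ u in t..T, g u * Real.exp (-∫ τ in (0:ℝ)..u, r τ) *
      (∫ s in Ioc u T, Real.exp (-∫ τ in u..s, (r τ - g τ)) ∂ν)
    = ∫ s in Ioc t T, Real.exp (-∫ τ in (0:ℝ)..s, r τ)
            * (Real.exp (∫ τ in t..s, g τ) - 1) ∂ν := by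
  have hC0 : 0 ≤ C := (abs_nonneg _).trans (hrC 0)
  have hir := ts_ii hr hrC
  have hig := ts_ii hg hgC
  have cR : Continuous fun s => ∫ τ in (0:ℝ)..s, r τ := intervalIntegral.continuous_primitive hir 0
  have cG : Continuous fun s => ∫ τ in (0:ℝ)..s, g τ := intervalIntegral.continuous_primitive hig 0
  have eG : ∀ u s, ∫ τ in u..s, g τ = (∫ τ in (0:ℝ)..s, g τ) - ∫ τ in (0:ℝ)..u, g τ := fun u s =>
    (intervalIntegral.integral_interval_sub_left (hig _ _) (hig _ _)).symm
  have eR : ∀ u s, ∫ τ in u..s, r τ = (∫ τ in (0:ℝ)..s, r τ) - ∫ τ in (0:ℝ)..u, r τ := fun u s =>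
    (intervalIntegral.integral_interval_sub_left (hir _ _) (hir _ _)).symm
  set H : ℝ → ℝ → ℝ := fun u s => Real.exp (-∫ τ in (0:ℝ)..s, r τ) *
    (g u * Real.exp (∫ τ in u..s, g τ)) with hH
  set S : Set (ℝ × ℝ) := {p | p.1 < p.2} with hS
  have hSm : MeasurableSet S := measurableSet_lt measurable_fst measurable_snd
  -- left side
  have hL : ∫ u in t..T, g u * Real.exp (-∫ τ in (0:ℝ)..u, r τ) *
      (∫ s in Ioc u T, Real.exp (-∫ τ in u..s, (r τ - g τ)) ∂ν)
      = ∫ u in Ioc t T, ∫ s in Ioc t T, S.indicator (Function.uncurry H) (u, s) ∂ν := by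
    rw [intervalIntegral.integral_of_le htT]
    refine setIntegral_congr_fun measurableSet_Ioc fun u hu => ?_
    have : ∀ s, S.indicator (Function.uncurry H) (u, s) = (Ioi u).indicator (H u) s := fun s => rfl
    simp_rw [this]
    rw [setIntegral_indicator measurableSet_Ioi]
    have h2 : Ioc t T ∩ Ioi u = Ioc u T := by
      ext s; simp only [mem_inter_iff, mem_Ioc, mem_Ioi]
      constructor
      · rintro ⟨⟨_, h⟩, h'⟩; exact ⟨h', h⟩
      · rintro ⟨h, h'⟩; exact ⟨⟨hu.1.trans h, h'⟩, h⟩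
    rw [h2, ← integral_const_mul]
    congr 1
    funext s
    rw [intervalIntegral.integral_sub (hir _ _) (hig _ _), hH]
    simp only
    rw [mul_assoc, ← Real.exp_add, mul_left_comm, ← Real.exp_add, eR u s]
    congr 2; ring
  have hHm : Measurable (Function.uncurry H) := by
    have : Function.uncurry H = fun p : ℝ × ℝ => Real.exp (-∫ τ in (0:ℝ)..p.2, r τ) *
      (g p.1 * Real.exp ((∫ τ in (0:ℝ)..p.2, g τ) - ∫ τ in (0:ℝ)..p.1, g τ)) := by
      funext p; simp only [Function.uncurry, hH]; rw [eG]
    rw [this]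
    have a1 := cR.measurable
    have a2 := cG.measurable
    have b1 := a1.comp (measurable_snd : Measurable (Prod.snd : ℝ × ℝ → ℝ))
    have b2 := a2.comp (measurable_snd : Measurable (Prod.snd : ℝ × ℝ → ℝ))
    have b3 := a2.comp (measurable_fst : Measurable (Prod.fst : ℝ × ℝ → ℝ))
    have b4 := hg.comp (measurable_fst : Measurable (Prod.fst : ℝ × ℝ → ℝ))
    exact b1.neg.exp.mul (b4.mul (b2.sub b3).exp)
  have hint : Integrable (S.indicator (Function.uncurry H))
      ((volume.restrict (Ioc t T)).prod (ν.restrict (Ioc t T))) := by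
    obtain ⟨M1, hM1⟩ := isCompact_Icc.exists_bound_of_continuousOn (s := Icc t T)
      (f := fun s => Real.exp (-∫ τ in (0:ℝ)..s, r τ)) (by fun_prop)
    have hM : ∀ u ∈ Ioc t T, ∀ s ∈ Ioc t T, ‖H u s‖ ≤ M1 * (C * Real.exp (C * (T - t))) := by
      intro u hu s hs
      rw [hH]; simp only
      rw [norm_mul, norm_mul]
      gcongr
      · exact (norm_nonneg _).trans (hM1 s ⟨hs.1.le, hs.2⟩)
      · exact hM1 s ⟨hs.1.le, hs.2⟩
      · exact hgC u
      · rw [Real.norm_eq_abs, Real.abs_exp]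
        apply Real.exp_le_exp.2
        have := intervalIntegral.norm_integral_le_of_norm_le_const (a := u) (b := s) (f := g)
          (C := C) (fun x _ => hgC x)
        refine (le_abs_self _).trans (this.trans ?_)
        gcongr
        rw [abs_le]; constructor <;> linarith [hu.1, hu.2, hs.1, hs.2]
    refine Integrable.indicator ?_ hSm
    refine Integrable.of_bound hHm.aestronglyMeasurable (M1 * (C * Real.exp (C * (T - t)))) ?_
    rw [Measure.prod_restrict]
    filter_upwards [ae_restrict_mem (measurableSet_Ioc.prod measurableSet_Ioc)] with p hp
    exact hM p.1 hp.1 p.2 hp.2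
  rw [hL, integral_integral_swap (f := fun u s => S.indicator (Function.uncurry H) (u, s)) hint]
  refine setIntegral_congr_fun measurableSet_Ioc fun s hs => ?_
  have : ∀ u, S.indicator (Function.uncurry H) (u, s) = (Iio s).indicator (fun u => H u s) u :=
    fun u => rfl
  simp_rw [this]
  rw [setIntegral_indicator measurableSet_Iio]
  have h2 : Ioc t T ∩ Iio s = Ioo t s := by
    ext u; simp only [mem_inter_iff, mem_Ioc, mem_Iio, mem_Ioo]
    constructor
    · rintro ⟨⟨h, _⟩, h'⟩; exact ⟨h, h'⟩
    · rintro ⟨h, h'⟩; exact ⟨⟨h, (h'.trans_le hs.2).le⟩, h'⟩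
  rw [h2, ← integral_Ioc_eq_integral_Ioo, ← intervalIntegral.integral_of_le hs.1.le, hH]
  simp only
  rw [intervalIntegral.integral_const_mul, ts_calc hg hgC hs.1.le]

lemma ts_cond {Ω : Type*} {m mΩ : MeasurableSpace Ω} {μ : Measure Ω} [IsProbabilityMeasure μ]
    (hm : m ≤ mΩ) {t T : ℝ} (htT : t ≤ T) {W Z : ℝ → Ω → ℝ}
    (hW : Integrable (Function.uncurry W) ((volume.restrict (Ioc t T)).prod μ))
    (hZ : Integrable (Function.uncurry Z) ((volume.restrict (Ioc t T)).prod μ))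
    (h : ∀ u ∈ Ioc t T, ∀ A, MeasurableSet[m] A → ∫ ω in A, W u ω ∂μ = ∫ ω in A, Z u ω ∂μ) :
    μ[fun ω => ∫ u in t..T, W u ω|m] =ᵐ[μ] μ[fun ω => ∫ u in t..T, Z u ω|m] := by
  simp_rw [intervalIntegral.integral_of_le htT]
  have iW : Integrable (fun ω => ∫ u in Ioc t T, W u ω) μ := hW.integral_prod_right
  have iZ : Integrable (fun ω => ∫ u in Ioc t T, Z u ω) μ := hZ.integral_prod_right
  refine ae_eq_condExp_of_forall_setIntegral_eq hm iZ
    (fun _ _ _ => integrable_condExp.integrableOn) ?_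
    stronglyMeasurable_condExp.aestronglyMeasurable
  intro A hA _
  rw [setIntegral_condExp hm iW hA]
  have key : ∀ {Y : ℝ → Ω → ℝ},
      Integrable (Function.uncurry Y) ((volume.restrict (Ioc t T)).prod μ) →
      ∫ ω in A, (∫ u in Ioc t T, Y u ω) ∂μ = ∫ u in Ioc t T, ∫ ω in A, Y u ω ∂μ := by
    intro Y hY
    refine (integral_integral_swap (hY.mono_measure ?_)).symm
    exact Measure.prod_mono le_rfl Measure.restrict_le_self
  rw [key hW, key hZ]
  exact setIntegral_congr_fun measurableSet_Ioc fun u hu => h u hu A hA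

lemma ts_prog {Ω : Type*} {mΩ : MeasurableSpace Ω} (ℱ : Filtration ℝ mΩ) {r : ℝ → Ω → ℝ}
    (hr : ProgMeasurable ℱ r) {u : ℝ} (hu : 0 ≤ u) :
    Measurable[ℱ u] (r u) ∧ Measurable[ℱ u] (fun ω => ∫ τ in (0:ℝ)..u, r τ ω) := by
  have h := (hr u).measurable
  have h1 : @Measurable (ℝ × Ω) ℝ (@Prod.instMeasurableSpace _ _ _ (ℱ u)) _
      (Function.uncurry fun τ ω => r (min τ u) ω) := by
    letI : MeasurableSpace Ω := ℱ u
    have : Measurable (fun p : ℝ × Ω => ((⟨min p.1 u, mem_Iic.2 (min_le_right _ _)⟩ : Iic u), p.2)) := by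
      refine Measurable.prodMk ?_ measurable_snd
      exact (measurable_fst.min measurable_const).subtype_mk
    exact h.comp this
  constructor
  · have h2 : @Measurable _ _ (ℱ u) (@Prod.instMeasurableSpace _ _ _ (ℱ u)) (fun ω : Ω => (u, ω)) :=
      @measurable_prodMk_left _ _ _ (ℱ u) u
    have := h1.comp h2
    simpa [Function.comp_def, Function.uncurry] using this
  · have h3 := @ts_meas Ω (ℱ u) _ h1
    have h2 : @Measurable _ _ (ℱ u) (@Prod.instMeasurableSpace _ _ _ (ℱ u)) (fun ω : Ω => (u, ω)) :=
      @measurable_prodMk_left _ _ _ (ℱ u) u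
    have := h3.comp h2
    convert this using 1
    funext ω
    simp only [Function.comp]
    apply intervalIntegral.integral_congr
    intro τ hτ
    rw [uIcc_of_le hu] at hτ
    simp [min_eq_left hτ.2]

lemma ts_xi {Ω : Type*} {mΩ : MeasurableSpace Ω} {f : ℝ → Ω → ℝ} {C : ℝ}
    (hf : Measurable (Function.uncurry f)) (hC : ∀ u ω, |f u ω| ≤ C) (T : ℝ)
    (ν : Ω → Measure ℝ) (hν : Measurable ν) {D : ENNReal} (hD : D < ⊤)
    (hνD : ∀ ω, ν ω univ ≤ D) :
    Measurable (fun p : ℝ × Ω => ∫ s in Ioc p.1 T, Real.exp (-∫ τ in p.1..s, f τ p.2) ∂(ν p.2)) ∧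
    ∀ u ∈ Icc 0 T, ∀ ω, |∫ s in Ioc u T, Real.exp (-∫ τ in u..s, f τ ω) ∂(ν ω)|
      ≤ Real.exp (C * T) * D.toReal := by
  have hfω : ∀ ω, Measurable fun τ => f τ ω := fun ω => hf.comp measurable_prodMk_right
  constructor
  · let κ : ProbabilityTheory.Kernel (ℝ × Ω) ℝ := ⟨fun p => ν p.2, hν.comp measurable_snd⟩
    haveI : ProbabilityTheory.IsFiniteKernel κ := ⟨D, hD, fun p => hνD p.2⟩
    let S : Set ((ℝ × Ω) × ℝ) := {q | q.1.1 < q.2 ∧ q.2 ≤ T}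
    have hS : MeasurableSet S := by
      apply MeasurableSet.inter
      · exact measurableSet_lt (by fun_prop) measurable_snd
      · exact measurableSet_le measurable_snd measurable_const
    let E : (ℝ × Ω) × ℝ → ℝ := fun q => Real.exp (-∫ τ in q.1.1..q.2, f τ q.1.2)
    have hE : Measurable E := by
      have e : E = fun q => Real.exp (-((∫ τ in (0:ℝ)..q.2, f τ q.1.2)
          - ∫ τ in (0:ℝ)..q.1.1, f τ q.1.2)) := by
        funext q
        simp only [E]
        rw [intervalIntegral.integral_interval_sub_left (ts_ii (hfω _) (hC · _) _ _)
          (ts_ii (hfω _) (hC · _) _ _)]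
      rw [e]
      have m0 := ts_meas hf
      have m1 := m0.comp (measurable_snd.prodMk (measurable_snd.comp measurable_fst) :
        Measurable fun q : (ℝ × Ω) × ℝ => (q.2, q.1.2))
      have m2 := m0.comp (measurable_fst : Measurable (Prod.fst : (ℝ × Ω) × ℝ → ℝ × Ω))
      exact (m1.sub m2).neg.exp
    have := (StronglyMeasurable.integral_kernel_prod_right' (κ := κ)
      (hE.indicator hS).stronglyMeasurable).measurable
    convert this using 1
    funext p
    rw [← integral_indicator measurableSet_Ioc]
    rfl
  · intro u hu ω
    haveI : IsFiniteMeasure (ν ω) := ⟨(hνD ω).trans_lt hD⟩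
    have hC0 : 0 ≤ C := (abs_nonneg _).trans (hC 0 ω)
    have h1 := norm_setIntegral_le_of_norm_le_const (μ := ν ω) (s := Ioc u T)
      (f := fun s => Real.exp (-∫ τ in u..s, f τ ω)) (C := Real.exp (C * T))
      (measure_lt_top _ _) (by
        intro s hs
        rw [Real.norm_eq_abs, Real.abs_exp]
        apply Real.exp_le_exp.2
        have := intervalIntegral.norm_integral_le_of_norm_le_const (a := u) (b := s)
          (f := fun τ => f τ ω) (C := C) (fun x _ => hC x ω)
        refine (neg_le_abs _).trans (this.trans ?_)
        gcongr
        rw [abs_le]; constructor <;> linarith [hu.1, hu.2, hs.1, hs.2])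
    refine h1.trans ?_
    gcongr
    exact ENNReal.toReal_mono hD.ne ((measure_mono (subset_univ _)).trans (hνD ω))

/-- The central conditional-expectation computation in the proof of Lemma 3.1
(two-step risk-minimization): with `V(u) = E[ξ(u)|ℱ_u]` the value of future
payments `ν` discounted at the modified short rate `(1−γ)r − δ`, one has, a.s.,
`E[∫_t^T (γ(u)r(u)+δ(u)) e^{−∫_0^u r} V(u) du | ℱ_t]
  = E[∫_(t,T] e^{−∫_0^s r} (e^{∫_t^s (γr+δ)} − 1) ν(ds) | ℱ_t]`. -/
theorem two_step_conditional_expectation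
    {Ω : Type*} {mΩ : MeasurableSpace Ω} {μ : Measure Ω} [IsProbabilityMeasure μ]
    (ℱ : Filtration ℝ mΩ) (T : ℝ) (hT : 0 < T)
    (r γ δ : ℝ → Ω → ℝ)
    (hr : Measurable (Function.uncurry r)) (hγ : Measurable (Function.uncurry γ))
    (hδ : Measurable (Function.uncurry δ))
    (hr_prog : ProgMeasurable ℱ r) (hγ_prog : ProgMeasurable ℱ γ)
    (hδ_prog : ProgMeasurable ℱ δ)
    (hr_bdd : ∃ C : ℝ, ∀ u ω, |r u ω| ≤ C)
    (hδ_bdd : ∃ C : ℝ, ∀ u ω, |δ u ω| ≤ C)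
    (hγ01 : ∀ u ω, γ u ω ∈ Ico (0 : ℝ) 1)
    (ν : Ω → Measure ℝ) (hν : Measurable ν)
    (hν_bdd : ∃ C : ENNReal, C < ⊤ ∧ ∀ ω, ν ω Set.univ ≤ C)
    (V : ℝ → Ω → ℝ) (hV : Measurable (Function.uncurry V))
    (hVval : ∀ u ∈ Icc (0 : ℝ) T,
      V u =ᵐ[μ] μ[fun ω => ∫ s in Ioc u T,
        Real.exp (-∫ τ in u..s, ((1 - γ τ ω) * r τ ω - δ τ ω)) ∂(ν ω)|ℱ u]) :
    ∀ t ∈ Icc (0 : ℝ) T,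
      μ[fun ω => ∫ u in t..T,
          (γ u ω * r u ω + δ u ω) * Real.exp (-∫ τ in (0:ℝ)..u, r τ ω) * V u ω|ℱ t]
        =ᵐ[μ]
      μ[fun ω => ∫ s in Ioc t T,
          Real.exp (-∫ τ in (0:ℝ)..s, r τ ω)
            * (Real.exp (∫ τ in t..s, (γ τ ω * r τ ω + δ τ ω)) - 1) ∂(ν ω)|ℱ t] := by
  intro t ht
  obtain ⟨Cr, hCr⟩ := hr_bdd
  obtain ⟨Cd, hCd⟩ := hδ_bdd
  obtain ⟨D, hD, hνD⟩ := hν_bdd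
  obtain ⟨ω₀⟩ : Nonempty Ω := nonempty_of_isProbabilityMeasure μ
  have hCr0 : 0 ≤ Cr := (abs_nonneg _).trans (hCr 0 ω₀)
  have hCd0 : 0 ≤ Cd := (abs_nonneg _).trans (hCd 0 ω₀)
  set C := Cr + Cd with hCdef
  have hrC : ∀ u ω, |r u ω| ≤ C := fun u ω => (hCr u ω).trans (by linarith)
  have hγabs : ∀ u ω, |γ u ω| ≤ 1 := fun u ω => by
    rw [abs_le]; constructor <;> linarith [(hγ01 u ω).1, (hγ01 u ω).2]
  have hgC : ∀ u ω, |γ u ω * r u ω + δ u ω| ≤ C := fun u ω => by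
    refine (abs_add_le _ _).trans (add_le_add ?_ (hCd u ω))
    rw [abs_mul]
    nlinarith [hγabs u ω, hCr u ω, abs_nonneg (r u ω), abs_nonneg (γ u ω)]
  have hfC : ∀ u ω, |(1 - γ u ω) * r u ω - δ u ω| ≤ C := fun u ω => by
    refine (abs_sub _ _).trans (add_le_add ?_ (hCd u ω))
    have : |1 - γ u ω| ≤ 1 := by
      rw [abs_le]; constructor <;> linarith [(hγ01 u ω).1, (hγ01 u ω).2]
    rw [abs_mul]
    nlinarith [hCr u ω, abs_nonneg (r u ω), abs_nonneg (1 - γ u ω)]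
  have hgm : Measurable (Function.uncurry fun u ω => γ u ω * r u ω + δ u ω) :=
    (hγ.mul hr).add hδ
  have hfm : Measurable (Function.uncurry fun u ω => (1 - γ u ω) * r u ω - δ u ω) :=
    ((measurable_const.sub hγ).mul hr).sub hδ
  obtain ⟨hξm, hξb⟩ := ts_xi hfm hfC T ν hν hD hνD
  set ξ : ℝ → Ω → ℝ := fun u ω => ∫ s in Ioc u T,
        Real.exp (-∫ τ in u..s, ((1 - γ τ ω) * r τ ω - δ τ ω)) ∂(ν ω) with hξ
  set K : ℝ := Real.exp (C * T) * D.toReal with hK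
  let G : ℝ → Ω → ℝ := fun u ω =>
    (γ u ω * r u ω + δ u ω) * Real.exp (-∫ τ in (0:ℝ)..u, r τ ω)
  have hGm : Measurable (Function.uncurry G) := hgm.mul (ts_meas hr).neg.exp
  have hGb : ∀ u ∈ Icc 0 T, ∀ ω, |G u ω| ≤ C * Real.exp (C * T) := by
    intro u hu ω
    simp only [G]
    rw [abs_mul, Real.abs_exp]
    have hC0 : 0 ≤ C := by positivity
    gcongr
    · exact hgC u ω
    · have := intervalIntegral.norm_integral_le_of_norm_le_const (a := 0) (b := u)
          (f := fun τ => r τ ω) (C := C) (fun x _ => hrC x ω)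
      refine (neg_le_abs _).trans (this.trans ?_)
      gcongr
      rw [abs_le]; constructor <;> linarith [hu.1, hu.2]
  have hVb : ∀ u ∈ Icc 0 T, ∀ᵐ ω ∂μ, |V u ω| ≤ K := by
    intro u hu
    have h1 : ∀ᵐ ω ∂μ, |(μ[ξ u|ℱ u]) ω| ≤ K :=
      ae_bdd_abs_condExp_of_ae_bdd_abs (Filter.Eventually.of_forall (hξb u hu))
    filter_upwards [h1, hVval u hu] with ω h1 h2
    rw [h2]; exact h1
  have hsub : Ioc t T ⊆ Icc 0 T := fun u hu => ⟨ht.1.trans hu.1.le, hu.2⟩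
  have hint : ∀ {Y : ℝ → Ω → ℝ}, Measurable (Function.uncurry Y) →
      (∀ u ∈ Icc 0 T, ∀ᵐ ω ∂μ, |Y u ω| ≤ K) →
      Integrable (Function.uncurry fun u ω => G u ω * Y u ω)
        ((volume.restrict (Ioc t T)).prod μ) := by
    intro Y hY hYb
    have hm : Measurable (Function.uncurry fun u ω => G u ω * Y u ω) := hGm.mul hY
    refine Integrable.of_bound hm.aestronglyMeasurable (C * Real.exp (C * T) * K) ?_
    rw [Measure.ae_prod_iff_ae_ae (measurableSet_le hm.norm measurable_const)]
    filter_upwards [ae_restrict_mem measurableSet_Ioc] with u hu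
    filter_upwards [hYb u (hsub hu)] with ω hω
    show ‖G u ω * Y u ω‖ ≤ _
    rw [norm_mul]
    exact mul_le_mul (hGb u (hsub hu) ω) hω (abs_nonneg _) (by positivity)
  have hmain := ts_cond (μ := μ) (ℱ.le t) ht.2 (hint hV hVb)
    (hint (Y := ξ) hξm (fun u hu => Filter.Eventually.of_forall (hξb u hu))) (by
      intro u hu A hA
      have hu' := hsub hu
      have hGu : StronglyMeasurable[ℱ u] (G u) := by
        have p1 := ts_prog ℱ hr_prog hu'.1
        have p2 := ts_prog ℱ hγ_prog hu'.1
        have p3 := ts_prog ℱ hδ_prog hu'.1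
        exact (((p2.1.mul p1.1).add p3.1).mul p1.2.neg.exp).stronglyMeasurable
      have hξu : Measurable (ξ u) := hξm.comp measurable_prodMk_left
      have hGu' : Measurable (G u) := hGm.comp measurable_prodMk_left
      have iξ : Integrable (ξ u) μ := Integrable.of_bound hξu.aestronglyMeasurable K
        (Filter.Eventually.of_forall (hξb u hu'))
      have iGξ : Integrable (G u * ξ u) μ :=
        iξ.bdd_mul (c := C * Real.exp (C * T)) hGu'.aestronglyMeasurable
          (Filter.Eventually.of_forall (hGb u hu'))
      have h1 := condExp_mul_of_stronglyMeasurable_left (μ := μ) hGu iGξ iξ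
      have h2 : (fun ω => G u ω * V u ω) =ᵐ[μ] μ[G u * ξ u|ℱ u] := by
        filter_upwards [h1, hVval u hu'] with ω h1 h2
        rw [h1, h2]; rfl
      have hA' : MeasurableSet[ℱ u] A := ℱ.mono hu.1.le A hA
      rw [integral_congr_ae (ae_restrict_of_ae h2), setIntegral_condExp (ℱ.le u) iGξ hA']
      rfl)
  refine hmain.trans (Filter.EventuallyEq.of_eq ?_)
  congr 1
  funext ω
  haveI : IsFiniteMeasure (ν ω) := ⟨(hνD ω).trans_lt hD⟩
  rw [← ts_path (r := fun τ => r τ ω) (g := fun τ => γ τ ω * r τ ω + δ τ ω)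
    (hr.comp measurable_prodMk_right) (hgm.comp measurable_prodMk_right)
    (hrC · ω) (hgC · ω) ht.2 (ν ω)]
  simp only [G, hξ]
  have e : ∀ τ, (1 - γ τ ω) * r τ ω - δ τ ω = r τ ω - (γ τ ω * r τ ω + δ τ ω) := fun τ => by ring
  simp_rw [e]
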